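/- arXiv:1506.01931 — 2 statements merged into one kernel-verified Lean document; each statement's English description precedes it below -/
import Mathlib

section
/- Let A be a symmetric (n+1)×(n+1) matrix over ℂ having n+1 pairwise distinct eigenvalues, and let v ∈ ℂⁿ⁺¹ be a nonzero eigenvector of A. Then ⟨v, v⟩ = vᵀ•v ≠ 0, i.e. v is not isotropic for the standard symmetric bilinear form. -/
open Matrix

/-- Eigenvectors of a symmetric matrix with distinct eigenvalues are orthogonal for the
standard bilinear form. -/
theorem dotProduct_eq_zero_of_mulVec_eq_smul {R m : Type*} [CommRing R] [IsDomain R] [Fintype m]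
    {A : Matrix m m R} (hA : Aᵀ = A) {v w : m → R} {a b : R}
    (hv : A *ᵥ v = a • v) (hw : A *ᵥ w = b • w) (hab : b ≠ a) : v ⬝ᵥ w = 0 := by
  have h : b * (v ⬝ᵥ w) = a * (v ⬝ᵥ w) := by
    calc b * (v ⬝ᵥ w) = v ⬝ᵥ A *ᵥ w := by rw [hw, dotProduct_smul, smul_eq_mul]
      _ = a * (v ⬝ᵥ w) := by
        rw [dotProduct_mulVec, ← mulVec_transpose, hA, hv, smul_dotProduct, smul_eq_mul]
  by_contra h0
  exact hab (mul_right_cancel₀ h0 h)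

/-- If a complex symmetric `(n+1)×(n+1)` matrix has `n+1` pairwise distinct
eigenvalues, then no nonzero eigenvector is isotropic for the standard symmetric
bilinear form: `vᵀ • v ≠ 0`. -/
theorem eigenvector_not_isotropic
    (n : ℕ) (A : Matrix (Fin (n + 1)) (Fin (n + 1)) ℂ)
    (hAsymm : Aᵀ = A)
    (μ : Fin (n + 1) → ℂ) (hμinj : Function.Injective μ)
    (heig : ∀ i, ∃ v : Fin (n + 1) → ℂ, v ≠ 0 ∧ A *ᵥ v = μ i • v)
    (v : Fin (n + 1) → ℂ) (hv : v ≠ 0) (lam : ℂ) (hlam : A *ᵥ v = lam • v) :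
    v ⬝ᵥ v ≠ 0 := by
  intro h0
  have hfam : ∀ i, ∃ w : Fin (n + 1) → ℂ, (w ≠ 0 ∧ A *ᵥ w = μ i • w) ∧ v ⬝ᵥ w = 0 := by
    intro i
    by_cases hi : μ i = lam
    · exact ⟨v, ⟨hv, hi ▸ hlam⟩, h0⟩
    · obtain ⟨w, hw0, hw⟩ := heig i
      exact ⟨w, ⟨hw0, hw⟩, dotProduct_eq_zero_of_mulVec_eq_smul hAsymm hlam hw hi⟩
  choose w hw hvw using hfam
  have hli : LinearIndependent ℂ w :=
    Module.End.eigenvectors_linearIndependent' A.mulVecLin μ hμinj w fun i ↦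
      ⟨Module.End.mem_eigenspace_iff.2 (hw i).2, (hw i).1⟩
  have hspan : Submodule.span ℂ (Set.range w) = ⊤ :=
    hli.span_eq_top_of_card_eq_finrank' (by simp)
  refine hv (dotProduct_eq_zero v fun u ↦ ?_)
  have hu : u ∈ Submodule.span ℂ (Set.range w) := hspan ▸ Submodule.mem_top
  induction hu using Submodule.span_induction with
  | mem x hx => obtain ⟨i, rfl⟩ := hx; exact hvw i
  | zero => exact dotProduct_zero v
  | add x y _ _ hx hy => rw [dotProduct_add, hx, hy, add_zero]
  | smul c x _ hx => rw [dotProduct_smul, hx, smul_zero]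
end

section
/- Let n ≥ 1 and let A and B be invertible symmetric (n+1)×(n+1) matrices over ℂ such that the polynomial t ↦ det(A + t•B) has n+1 pairwise distinct complex roots. Then there exist an invertible matrix P, nonzero scalars s and s′, and nonzero complex numbers a₀, …, a_{n−1}, b₀, …, b_{n−1} such that s•(Pᵀ•A•P) = diag(a₀, …, a_{n−1}, −1), s′•(Pᵀ•B•P) = diag(b₀, …, b_{n−1}, −1), with aᵢ ≠ bᵢ for every i and aᵢ•bⱼ ≠ aⱼ•bᵢ for all i ≠ j. -/
open Matrix

/-- A matrix whose columns are kernel vectors of the members `A + t i • B` of a pencil, for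
distinct `t i`, is invertible. -/
theorem exists_isUnit_mul_eq_neg_mul_diagonal {K m : Type*} [Field K] [Fintype m] [DecidableEq m]
    {A B : Matrix m m K} (hB : IsUnit B) {t : m → K} (ht : Function.Injective t)
    (hroots : ∀ i, (A + t i • B).det = 0) :
    ∃ M : Matrix m m K, IsUnit M ∧ A * M = -(B * M * Matrix.diagonal t) := by
  choose v hv0 hv using fun i => Matrix.exists_mulVec_eq_zero_iff.mpr (hroots i)
  have hAv (i : m) : A *ᵥ v i = -(t i • (B *ᵥ v i)) := by
    rw [eq_neg_iff_add_eq_zero, ← Matrix.smul_mulVec, ← Matrix.add_mulVec, hv i]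
  have hli : LinearIndependent K v := by
    refine Module.End.eigenvectors_linearIndependent' (Matrix.toLin' (B⁻¹ * A)) (fun i => -t i)
      (neg_injective.comp ht) v fun i => ?_
    refine Module.End.hasEigenvector_iff.mpr ⟨Module.End.mem_eigenspace_iff.mpr ?_, hv0 i⟩
    rw [Matrix.toLin'_apply, ← Matrix.mulVec_mulVec, hAv, Matrix.mulVec_neg, Matrix.mulVec_smul,
      Matrix.mulVec_mulVec, Matrix.nonsing_inv_mul B ((Matrix.isUnit_iff_isUnit_det B).mp hB),
      Matrix.one_mulVec, neg_smul]
  refine ⟨(Matrix.of v)ᵀ, Matrix.linearIndependent_cols_iff_isUnit.mp hli, ?_⟩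
  ext k i
  rw [Matrix.neg_apply, Matrix.mul_diagonal, mul_comm]
  exact congrFun (hAv i) k

/-- A regular pencil of symmetric matrices with as many distinct roots as its size is
simultaneously diagonalizable by a congruence. -/
theorem exists_isUnit_congr_diagonal {K m : Type*} [Field K] [Fintype m] [DecidableEq m]
    {A B : Matrix m m K} (hB : IsUnit B) (hAsymm : Aᵀ = A) (hBsymm : Bᵀ = B)
    {t : m → K} (ht : Function.Injective t) (hroots : ∀ i, (A + t i • B).det = 0) :
    ∃ (M : Matrix m m K) (d : m → K), IsUnit M ∧ (∀ i, d i ≠ 0) ∧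
      Mᵀ * B * M = Matrix.diagonal d ∧ Mᵀ * A * M = Matrix.diagonal fun i => -(d i * t i) := by
  obtain ⟨M, hM, hAM⟩ := exists_isUnit_mul_eq_neg_mul_diagonal hB ht hroots
  have hAD : Mᵀ * A * M = -(Mᵀ * B * M * Matrix.diagonal t) := by
    rw [Matrix.mul_assoc, hAM, Matrix.mul_neg]
    simp only [Matrix.mul_assoc]
  have hsymm {C : Matrix m m K} (hC : Cᵀ = C) : (Mᵀ * C * M)ᵀ = Mᵀ * C * M := by
    simp [Matrix.transpose_mul, hC, Matrix.mul_assoc]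
  have hdiag : Mᵀ * B * M = Matrix.diagonal fun i => (Mᵀ * B * M) i i := by
    ext i j
    rcases eq_or_ne i j with rfl | hij
    · simp
    rw [Matrix.diagonal_apply_ne _ hij]
    have hDij := congrFun (congrFun (hsymm hBsymm) i) j
    have hAij := congrFun (congrFun (hsymm hAsymm) i) j
    rw [hAD, Matrix.transpose_apply, Matrix.neg_apply, Matrix.neg_apply, Matrix.mul_diagonal,
      Matrix.mul_diagonal, neg_inj] at hAij
    rw [Matrix.transpose_apply] at hDij
    rw [hDij] at hAij
    by_contra h0
    exact hij (ht (mul_left_cancel₀ h0 hAij))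
  have hunit : IsUnit (Mᵀ * B * M) :=
    (((Matrix.isUnit_transpose M).mpr hM).mul hB).mul hM
  refine ⟨M, fun i => (Mᵀ * B * M) i i, hM, fun i => ?_, hdiag, ?_⟩
  · rw [hdiag, Matrix.isUnit_diagonal, Pi.isUnit_iff] at hunit
    exact (hunit i).ne_zero
  · rw [hAD]
    nth_rewrite 1 [hdiag]
    rw [Matrix.diagonal_mul_diagonal, Matrix.diagonal_neg]

/-- Two invertible symmetric complex matrices whose pencil determinant
has `n+1` pairwise distinct roots can be simultaneously brought, up to nonzero
scalars, to the diagonal forms `diag(a₀, …, a_{n−1}, −1)` and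
`diag(b₀, …, b_{n−1}, −1)` with all `aᵢ, bᵢ` nonzero, `aᵢ ≠ bᵢ`, and
`aᵢbⱼ ≠ aⱼbᵢ` for `i ≠ j`. -/
theorem pair_of_quadrics_normal_form
    (n : ℕ) (hn : 1 ≤ n)
    (A B : Matrix (Fin (n + 1)) (Fin (n + 1)) ℂ)
    (hA : IsUnit A) (hB : IsUnit B)
    (hAsymm : Aᵀ = A) (hBsymm : Bᵀ = B)
    (t : Fin (n + 1) → ℂ) (htinj : Function.Injective t)
    (hroots : ∀ i, (A + t i • B).det = 0) :
    ∃ (P : Matrix (Fin (n + 1)) (Fin (n + 1)) ℂ) (s s' : ℂ) (a b : Fin n → ℂ),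
      IsUnit P ∧ s ≠ 0 ∧ s' ≠ 0 ∧
      (∀ i, a i ≠ 0) ∧ (∀ i, b i ≠ 0) ∧
      s • (Pᵀ * A * P) = Matrix.diagonal (Fin.snoc a (-1)) ∧
      s' • (Pᵀ * B * P) = Matrix.diagonal (Fin.snoc b (-1)) ∧
      (∀ i, a i ≠ b i) ∧
      (∀ i j, i ≠ j → a i * b j ≠ a j * b i) := by
  obtain ⟨M, d, hM, hd, hBM, hAM⟩ :=
    exists_isUnit_congr_diagonal hB hAsymm hBsymm htinj hroots
  have ht0 (i : Fin (n + 1)) : t i ≠ 0 := by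
    have hunit : IsUnit (Mᵀ * A * M) := (((Matrix.isUnit_transpose M).mpr hM).mul hA).mul hM
    rw [hAM, Matrix.isUnit_diagonal, Pi.isUnit_iff] at hunit
    exact right_ne_zero_of_mul (neg_ne_zero.mp (hunit i).ne_zero)
  have hdl := hd (Fin.last n)
  have htl := ht0 (Fin.last n)
  refine ⟨M, (d (Fin.last n) * t (Fin.last n))⁻¹, -(d (Fin.last n))⁻¹,
    fun i => -(d i.castSucc * t i.castSucc) / (d (Fin.last n) * t (Fin.last n)),
    fun i => -d i.castSucc / d (Fin.last n), hM, inv_ne_zero (mul_ne_zero hdl htl),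
    neg_ne_zero.mpr (inv_ne_zero hdl),
    fun i => div_ne_zero (neg_ne_zero.mpr (mul_ne_zero (hd _) (ht0 _))) (mul_ne_zero hdl htl),
    fun i => div_ne_zero (neg_ne_zero.mpr (hd _)) hdl, ?_, ?_, fun i h => ?_,
    fun i j hij h => hij ?_⟩
  · rw [hAM, ← Matrix.diagonal_smul]
    congr 1
    funext i
    refine Fin.lastCases ?_ (fun j => ?_) i
    · simp only [Pi.smul_apply, smul_eq_mul, Fin.snoc_last]
      field_simp
    · simp only [Pi.smul_apply, smul_eq_mul, Fin.snoc_castSucc]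
      field_simp
  · rw [hBM, ← Matrix.diagonal_smul]
    congr 1
    funext i
    refine Fin.lastCases ?_ (fun j => ?_) i
    · simp only [Pi.smul_apply, smul_eq_mul, Fin.snoc_last]
      field_simp
    · simp only [Pi.smul_apply, smul_eq_mul, Fin.snoc_castSucc]
      field_simp
  · have hdi := hd i.castSucc
    field_simp at h
    refine (Fin.castSucc_lt_last i).ne (htinj ?_)
    linear_combination -h
  · have hdi := hd i.castSucc
    have hdj := hd j.castSucc
    field_simp at h
    refine Fin.castSucc_injective n (htinj ?_)
    linear_combination h
end
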